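/- The affine extension of the vector representation of type C_n satisfies the index-0 relations: e_0(u)f_0(u) − f_0(u)e_0(u) = (ω_0 − ω_0′)/(r² − s²), ω_0 e_0(u) ω_0^{−1} = r²s^{−2} e_0(u), ω_0 f_0(u) ω_0^{−1} = r^{−2}s² f_0(u), ω_0′ e_0(u) ω_0′^{−1} = r^{−2}s² e_0(u), ω_0′ f_0(u) ω_0′^{−1} = r²s^{−2} f_0(u), ω_n e_0(u) ω_n^{−1} = (rs)² e_0(u), ω_n f_0(u) ω_n^{−1} = (rs)^{−2} f_0(u), ω_n′ e_0(u) ω_n′^{−1} = (rs)² e_0(u), and ω_n′ f_0(u) ω_n′^{−1} = (rs)^{−2} f_0(u). -/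

import Mathlib

noncomputable section

open Finset
open scoped Kronecker

set_option maxHeartbeats 1000000

abbrev K : Type := FractionRing (MvPolynomial (Fin 3) ℚ)

def ρ : K := algebraMap (MvPolynomial (Fin 3) ℚ) K (MvPolynomial.X 0)
def σ' : K := algebraMap (MvPolynomial (Fin 3) ℚ) K (MvPolynomial.X 1)
def r : K := ρ ^ 2
def s : K := σ' ^ 2
def uVar : K := algebraMap (MvPolynomial (Fin 3) ℚ) K (MvPolynomial.X 2)

abbrev M (n : ℕ) := Matrix (Fin (2*n)) (Fin (2*n)) K
abbrev M2 (n : ℕ) := Matrix (Fin (2*n) × Fin (2*n)) (Fin (2*n) × Fin (2*n)) K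

/-- the matrix unit `E_{kl}` (1-based indices). -/
def E (n k l : ℕ) : M n :=
  Matrix.of fun a b => if a.val + 1 = k ∧ b.val + 1 = l then (1 : K) else 0

def eMat (n i : ℕ) : M n :=
  if i = n then (ρ⁻¹ * σ'⁻¹) • E n (n+1) n
  else (ρ⁻¹ * σ'⁻¹) • E n (i+1) i - E n (2*n-i+1) (2*n-i)

def fMat (n i : ℕ) : M n :=
  if i = n then (ρ⁻¹ * σ'⁻¹) • E n n (n+1)
  else (ρ⁻¹ * σ'⁻¹) • E n i (i+1) - E n (2*n-i) (2*n-i+1)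

def ωMat (n i : ℕ) : M n :=
  if i = n then
    ∑ j ∈ Icc 1 (2*n),
      (if j ≤ n - 1 then r * s else if j = n then r⁻¹ * s else if j = n + 1 then r * s⁻¹
       else r⁻¹ * s⁻¹) • E n j j
  else
    ∑ j ∈ Icc 1 (2*n),
      (if j = i then r⁻¹ else if j = i + 1 then s⁻¹ else if j = 2*n - i then s
       else if j = 2*n - i + 1 then r else 1) • E n j j

def ω'Mat (n i : ℕ) : M n :=
  if i = n then
    ∑ j ∈ Icc 1 (2*n),
      (if j ≤ n - 1 then r * s else if j = n then r * s⁻¹ else if j = n + 1 then r⁻¹ * s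
       else r⁻¹ * s⁻¹) • E n j j
  else
    ∑ j ∈ Icc 1 (2*n),
      (if j = i then s⁻¹ else if j = i + 1 then r⁻¹ else if j = 2*n - i then r
       else if j = 2*n - i + 1 then s else 1) • E n j j

def ω0 (n : ℕ) : M n :=
  ∑ j ∈ Icc 1 (2*n),
    (if j = 1 then r * s⁻¹ else if j = 2 then r * s else if j = 2*n - 1 then r⁻¹ * s⁻¹
     else if j = 2*n then r⁻¹ * s else 1) • E n j j

def ω0' (n : ℕ) : M n :=
  ∑ j ∈ Icc 1 (2*n),
    (if j = 1 then r⁻¹ * s else if j = 2 then r * s else if j = 2*n - 1 then r⁻¹ * s⁻¹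
     else if j = 2*n then r * s⁻¹ else 1) • E n j j

def e0 (n : ℕ) (t : K) : M n := (ρ⁻¹ * σ'⁻¹ * t) • E n 1 (2*n)

def f0 (n : ℕ) (t : K) : M n := (ρ⁻¹ * σ'⁻¹ * t⁻¹) • E n (2*n) 1

lemma hρ : ρ ≠ 0 := by
  unfold ρ
  exact (map_ne_zero_iff _ (IsFractionRing.injective _ K)).2 (MvPolynomial.X_ne_zero _)
lemma hσ : σ' ≠ 0 := by
  unfold σ'
  exact (map_ne_zero_iff _ (IsFractionRing.injective _ K)).2 (MvPolynomial.X_ne_zero _)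
lemma hu : uVar ≠ 0 := by
  unfold uVar
  exact (map_ne_zero_iff _ (IsFractionRing.injective _ K)).2 (MvPolynomial.X_ne_zero _)
lemma hr : r ≠ 0 := pow_ne_zero _ hρ
lemma hs : s ≠ 0 := pow_ne_zero _ hσ
lemma hrs : r ^ 2 - s ^ 2 ≠ 0 := by
  unfold r s ρ σ'
  rw [← map_pow, ← map_pow, ← map_pow, ← map_pow, ← map_sub]
  refine (map_ne_zero_iff _ (IsFractionRing.injective _ K)).2 ?_
  intro h
  have := congrArg (MvPolynomial.eval (fun i : Fin 3 => if i = 0 then (1:ℚ) else 0)) h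
  simp at this

lemma sum_diag (n : ℕ) (c : ℕ → K) :
    ∑ j ∈ Icc 1 (2*n), c j • E n j j = Matrix.diagonal (fun a : Fin (2*n) => c (a.val+1)) := by
  ext a b
  rw [Matrix.sum_apply, Finset.sum_eq_single (a.val+1)]
  · by_cases h : a = b
    · subst h; simp [E]
    · have : ¬ b.val = a.val := fun h' => h (Fin.ext h'.symm)
      simp [E, Matrix.diagonal_apply_ne _ h, this]
  · intro j _ hj
    simp [E, Ne.symm hj]
  · intro h
    exact absurd (Finset.mem_Icc.2 ⟨by omega, by omega⟩) h

lemma conj_E (n k l : ℕ) (c : ℕ → K) (hc : ∀ j, c j ≠ 0) (x z : K)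
    (hz : c k = z * c l) :
    (∑ j ∈ Icc 1 (2*n), c j • E n j j) * (x • E n k l) * (∑ j ∈ Icc 1 (2*n), c j • E n j j)⁻¹
      = z • (x • E n k l) := by
  rw [sum_diag]
  have hd : IsUnit (Matrix.diagonal (fun a : Fin (2*n) => c (a.val+1))).det := by
    rw [Matrix.det_diagonal]
    exact (Finset.prod_ne_zero_iff.2 fun a _ => hc _).isUnit
  have key : Matrix.diagonal (fun a : Fin (2*n) => c (a.val+1)) * (x • E n k l)
      = (z • (x • E n k l)) * Matrix.diagonal (fun a : Fin (2*n) => c (a.val+1)) := by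
    ext a b
    rw [Matrix.diagonal_mul, Matrix.mul_diagonal]
    by_cases h : a.val + 1 = k ∧ b.val + 1 = l
    · obtain ⟨rfl, rfl⟩ := h
      simp [E, hz]; ring
    · simp [E, h]
  rw [key, Matrix.mul_assoc, Matrix.mul_nonsing_inv _ hd, Matrix.mul_one]

lemma E_mul (n k l m : ℕ) (h1 : 1 ≤ l) (h2 : l ≤ 2*n) : E n k l * E n l m = E n k m := by
  ext a b
  rw [Matrix.mul_apply, Finset.sum_eq_single (⟨l-1, by omega⟩ : Fin (2*n))]
  · have : l - 1 + 1 = l := by omega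
    by_cases ha : a.val + 1 = k <;> by_cases hb : b.val + 1 = m <;> simp [E, this, ha, hb]
  · intro j _ hj
    have : ¬ j.val + 1 = l := fun h => hj (Fin.ext (by simp; omega))
    simp [E, this]
  · simp

/-- index-0 relations of the affine extension. -/
theorem stmt6 (n : ℕ) (hn : 2 ≤ n) :
    e0 n uVar * f0 n uVar - f0 n uVar * e0 n uVar = (r ^ 2 - s ^ 2)⁻¹ • (ω0 n - ω0' n) ∧
    ω0 n * e0 n uVar * (ω0 n)⁻¹ = (r ^ (2 : ℤ) * s ^ (-2 : ℤ)) • e0 n uVar ∧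
    ω0 n * f0 n uVar * (ω0 n)⁻¹ = (r ^ (-2 : ℤ) * s ^ (2 : ℤ)) • f0 n uVar ∧
    ω0' n * e0 n uVar * (ω0' n)⁻¹ = (r ^ (-2 : ℤ) * s ^ (2 : ℤ)) • e0 n uVar ∧
    ω0' n * f0 n uVar * (ω0' n)⁻¹ = (r ^ (2 : ℤ) * s ^ (-2 : ℤ)) • f0 n uVar ∧
    ωMat n n * e0 n uVar * (ωMat n n)⁻¹ = ((r * s) ^ 2) • e0 n uVar ∧
    ωMat n n * f0 n uVar * (ωMat n n)⁻¹ = ((r * s) ^ (-2 : ℤ)) • f0 n uVar ∧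
    ω'Mat n n * e0 n uVar * (ω'Mat n n)⁻¹ = ((r * s) ^ 2) • e0 n uVar ∧
    ω'Mat n n * f0 n uVar * (ω'Mat n n)⁻¹ = ((r * s) ^ (-2 : ℤ)) • f0 n uVar := by
  have hr := hr
  have hs := hs
  have a1 : ¬ (2*n = 1) := by omega
  have a2 : ¬ (2*n = 2) := by omega
  have a3 : ¬ (2*n = 2*n-1) := by omega
  have a4 : ¬ (2*n ≤ n-1) := by omega
  have a5 : ¬ (2*n = n) := by omega
  have a6 : ¬ (2*n = n+1) := by omega
  have a7 : 1 ≤ n-1 := by omega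
  refine ⟨?_, ?_, ?_, ?_, ?_, ?_, ?_, ?_, ?_⟩
  · have hρ := hρ
    have hσ := hσ
    have hu := hu
    have hrs := hrs
    unfold e0 f0 ω0 ω0'
    rw [smul_mul_smul_comm, smul_mul_smul_comm, E_mul _ _ _ _ (by omega) (by omega),
      E_mul _ _ _ _ (by omega) (by omega), sum_diag, sum_diag, Matrix.diagonal_sub]
    have hx : ρ⁻¹ * σ'⁻¹ * uVar * (ρ⁻¹ * σ'⁻¹ * uVar⁻¹) = r⁻¹ * s⁻¹ := by
      unfold r s; field_simp
    have hx' : ρ⁻¹ * σ'⁻¹ * uVar⁻¹ * (ρ⁻¹ * σ'⁻¹ * uVar) = r⁻¹ * s⁻¹ := by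
      unfold r s; field_simp
    have h1 : r⁻¹ * s⁻¹ = (r^2 - s^2)⁻¹ * (r * s⁻¹ - r⁻¹ * s) := by
      field_simp
    have h2 : -(r⁻¹ * s⁻¹) = (r^2 - s^2)⁻¹ * (r⁻¹ * s - r * s⁻¹) := by
      rw [h1]; ring
    rw [hx, hx']
    ext a b
    by_cases hab : a = b
    · subst hab
      rw [Matrix.smul_apply, Matrix.diagonal_apply_eq]
      generalize ha : a.val + 1 = j
      by_cases j1 : j = 1
      · subst j1
        have ha0 : a.val = 0 := by omega
        simp [E, ha0, Ne.symm a1]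
        simpa using h1
      · by_cases j2 : j = 2*n
        · subst j2
          have ha0 : ¬ a.val = 0 := by omega
          simp [E, ha, ha0, a1, a2, a3]
          simpa using h2
        · have ha0 : ¬ a.val = 0 := by omega
          simp [E, ha, ha0, j1, j2]
    · have h3 : ∀ k, ¬ (a.val + 1 = k ∧ b.val + 1 = k) := by
        rintro k ⟨h, h'⟩; exact hab (Fin.ext (by omega))
      simp only [E, Matrix.sub_apply, Matrix.smul_apply, Matrix.of_apply, h3,
        Matrix.diagonal_apply_ne _ hab]
      simp
  · unfold ω0 e0
    refine conj_E n _ _ (fun j => _) ?_ _ _ ?_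
    · intro j; split_ifs <;> simp [hr, hs]
    · simp only [a1, a2, a3, a4, a5, a6, a7, if_true, if_false]
      field_simp
  · unfold ω0 f0
    refine conj_E n _ _ (fun j => _) ?_ _ _ ?_
    · intro j; split_ifs <;> simp [hr, hs]
    · simp only [a1, a2, a3, a4, a5, a6, a7, if_true, if_false]
      field_simp
  · unfold ω0' e0
    refine conj_E n _ _ (fun j => _) ?_ _ _ ?_
    · intro j; split_ifs <;> simp [hr, hs]
    · simp only [a1, a2, a3, a4, a5, a6, a7, if_true, if_false]
      field_simp
  · unfold ω0' f0
    refine conj_E n _ _ (fun j => _) ?_ _ _ ?_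
    · intro j; split_ifs <;> simp [hr, hs]
    · simp only [a1, a2, a3, a4, a5, a6, a7, if_true, if_false]
      field_simp
  · unfold ωMat e0
    rw [if_pos rfl]
    refine conj_E n _ _ (fun j => _) ?_ _ _ ?_
    · intro j; split_ifs <;> simp [hr, hs]
    · simp only [a1, a2, a3, a4, a5, a6, a7, if_true, if_false]
      field_simp
  · unfold ωMat f0
    rw [if_pos rfl]
    refine conj_E n _ _ (fun j => _) ?_ _ _ ?_
    · intro j; split_ifs <;> simp [hr, hs]
    · simp only [a1, a2, a3, a4, a5, a6, a7, if_true, if_false]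
      field_simp
  · unfold ω'Mat e0
    rw [if_pos rfl]
    refine conj_E n _ _ (fun j => _) ?_ _ _ ?_
    · intro j; split_ifs <;> simp [hr, hs]
    · simp only [a1, a2, a3, a4, a5, a6, a7, if_true, if_false]
      field_simp
  · unfold ω'Mat f0
    rw [if_pos rfl]
    refine conj_E n _ _ (fun j => _) ?_ _ _ ?_
    · intro j; split_ifs <;> simp [hr, hs]
    · simp only [a1, a2, a3, a4, a5, a6, a7, if_true, if_false]
      field_simp

end
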